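/- arXiv:1805.11502 — 3 statements merged into one kernel-verified Lean document; each statement's English description precedes it below -/
import Mathlib

section
/- There exists an absolute constant K > 0 such that the following holds. For every prime N with N ≡ 3 (mod 4), all integers a, b coprime to N, and all integers c1, c2, c4, h1, h2 with 4c1c4 − c2² ≢ 0 (mod N), one has |L(c1,c2,c4,h1,h2) − δ·N²| ≤ K·N, where δ = 1 if h1 ≡ h2 ≡ 0 (mod N) and c1 ≡ c4, c2 ≡ 0 (mod N), and δ = 0 otherwise. -/
/-- `Lcount N a b c1 c2 c4 h1 h2` is the number of triples `(d1, d2, d4)` of residues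
modulo `N` satisfying `h1 ≡ a (d1 + d4) (mod N)`,
`(d1 d4 - d2²) h2 ≡ b (d4 c1 - d2 c2 + d1 c4) (mod N)` and `d1 d4 - d2² ≢ 0 (mod N)`. -/
noncomputable def Lcount (N : ℕ) (a b c1 c2 c4 h1 h2 : ℤ) : ℕ :=
  Nat.card {d : ZMod N × ZMod N × ZMod N //
    ((h1 : ZMod N) = (a : ZMod N) * (d.1 + d.2.2)) ∧
    ((d.1 * d.2.2 - d.2.1 ^ 2) * (h2 : ZMod N) =
      (b : ZMod N) * (d.2.2 * (c1 : ZMod N) - d.2.1 * (c2 : ZMod N) + d.1 * (c4 : ZMod N))) ∧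
    d.1 * d.2.2 - d.2.1 ^ 2 ≠ 0}

open Polynomial in
/-- A polynomial of degree one or two over a field has at most two roots. -/
theorem card_filter_quadratic_eq_zero_le {F : Type*} [Field F] [Fintype F] [DecidableEq F]
    (u v w : F) (h : u ≠ 0 ∨ v ≠ 0) :
    (Finset.univ.filter fun y : F => u * y ^ 2 + v * y + w = 0).card ≤ 2 := by
  set p : F[X] := C u * X ^ 2 + C v * X + C w with hp
  have hp0 : p ≠ 0 := by
    intro h0
    have h2 : p.coeff 2 = u := by simp [hp]
    have h1 : p.coeff 1 = v := by simp [hp]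
    rw [h0, coeff_zero] at h1 h2
    rcases h with h | h
    · exact h h2.symm
    · exact h h1.symm
  have hsub : (Finset.univ.filter fun y : F => u * y ^ 2 + v * y + w = 0) ⊆ p.roots.toFinset := by
    intro y hy
    rw [Multiset.mem_toFinset, mem_roots hp0]
    simpa [hp] using hy
  calc _ ≤ p.roots.toFinset.card := Finset.card_le_card hsub
    _ ≤ p.roots.card := Multiset.toFinset_card_le _
    _ ≤ p.natDegree := card_roots' p
    _ ≤ 2 := natDegree_quadratic_le

/-- If every point of `S` satisfies an equation of degree one or two in its second coordinate,
then `S` has at most `2 |F|` points. -/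
theorem card_le_two_mul_of_quadratic_snd {F : Type*} [Field F] [Fintype F] [DecidableEq F]
    (S : Finset (F × F)) (u : F) (v w : F → F) (h : ∀ x, u ≠ 0 ∨ v x ≠ 0)
    (hS : ∀ q ∈ S, u * q.2 ^ 2 + v q.1 * q.2 + w q.1 = 0) :
    S.card ≤ 2 * Fintype.card F := by
  refine Finset.card_le_mul_card_image_of_maps_to (f := Prod.fst) (t := Finset.univ)
    (fun _ _ => Finset.mem_univ _) 2 fun x _ => ?_
  refine le_trans ?_ (card_filter_quadratic_eq_zero_le u (v x) (w x) (h x))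
  refine Finset.card_le_card_of_injOn Prod.snd ?_ ?_
  · rintro ⟨x', y⟩ hq
    simp only [Finset.coe_filter, Set.mem_ofPred_eq] at hq
    obtain ⟨hq, rfl⟩ := hq
    simpa using hS _ hq
  · rintro ⟨x₁, y₁⟩ h₁ ⟨x₂, y₂⟩ h₂ h
    simp only [Finset.coe_filter, Set.mem_ofPred_eq] at h₁ h₂
    exact Prod.ext (h₁.2.trans h₂.2.symm) h

/-- Solving the trace condition for `d4` turns the count into one over pairs. -/
theorem Lcount_eq_card_filter (N : ℕ) [Fact N.Prime] (a b c1 c2 c4 h1 h2 : ℤ)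
    (ha : (a : ZMod N) ≠ 0) :
    Lcount N a b c1 c2 c4 h1 h2 =
      (Finset.univ.filter fun q : ZMod N × ZMod N =>
        (q.1 * ((h1 : ZMod N) / a - q.1) - q.2 ^ 2) * (h2 : ZMod N) =
          (b : ZMod N) * (((h1 : ZMod N) / a - q.1) * c1 - q.2 * c2 + q.1 * c4) ∧
        q.1 * ((h1 : ZMod N) / a - q.1) - q.2 ^ 2 ≠ 0).card := by
  rw [Lcount, ← Fintype.card_subtype, ← Nat.card_eq_fintype_card]
  have key : ∀ x z : ZMod N, (h1 : ZMod N) = a * (x + z) → z = (h1 : ZMod N) / a - x := by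
    intro x z h
    rw [h]
    field_simp
    ring
  refine Nat.card_congr
    { toFun := fun d => ⟨(d.1.1, d.1.2.1), ?_⟩
      invFun := fun q => ⟨(q.1.1, q.1.2, (h1 : ZMod N) / a - q.1.1), ?_, q.2⟩
      left_inv := ?_
      right_inv := fun _ => rfl }
  · obtain ⟨⟨x, y, z⟩, h, hq⟩ := d
    simpa only [← key x z h] using hq
  · simp only
    field_simp
    ring
  · rintro ⟨⟨x, y, z⟩, h, hq⟩
    simp only [← key x z h]

theorem ZMod.intCast_ne_zero_of_gcd_eq_one {N : ℕ} (hN : N.Prime) {a : ℤ}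
    (h : Int.gcd a N = 1) : (a : ZMod N) ≠ 0 := by
  intro h0
  rw [ZMod.intCast_zmod_eq_zero_iff_dvd] at h0
  have hd : N ∣ Int.gcd a N := Int.dvd_gcd h0 dvd_rfl
  rw [h] at hd
  exact hN.one_lt.ne' (Nat.dvd_one.mp hd)

theorem stmt0 :
    ∃ K : ℝ, 0 < K ∧
      ∀ N : ℕ, N.Prime → N % 4 = 3 →
        ∀ a b c1 c2 c4 h1 h2 : ℤ, Int.gcd a N = 1 → Int.gcd b N = 1 →
          ((4 * c1 * c4 - c2 ^ 2 : ℤ) : ZMod N) ≠ 0 →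
          |(Lcount N a b c1 c2 c4 h1 h2 : ℝ) -
              (if (h1 : ZMod N) = 0 ∧ (h2 : ZMod N) = 0 ∧
                  (c1 : ZMod N) = (c4 : ZMod N) ∧ (c2 : ZMod N) = 0
                then ((N : ℝ)) ^ 2 else 0)| ≤ K * N := by
  refine ⟨2, two_pos, fun N hN _ a b c1 c2 c4 h1 h2 ha hb hc => ?_⟩
  have : Fact N.Prime := ⟨hN⟩
  have hN2 : 2 * Fintype.card (ZMod N) ≤ 2 * N := by rw [ZMod.card]
  replace ha := ZMod.intCast_ne_zero_of_gcd_eq_one hN ha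
  replace hb := ZMod.intCast_ne_zero_of_gcd_eq_one hN hb
  push_cast at hc
  rw [Lcount_eq_card_filter N a b c1 c2 c4 h1 h2 ha]
  generalize (a : ZMod N) = a at *
  generalize (b : ZMod N) = b at *
  generalize (c1 : ZMod N) = c1 at *
  generalize (c2 : ZMod N) = c2 at *
  generalize (c4 : ZMod N) = c4 at *
  generalize (h1 : ZMod N) = h1 at *
  generalize (h2 : ZMod N) = h2 at *
  set S := Finset.univ.filter fun q : ZMod N × ZMod N =>
    (q.1 * (h1 / a - q.1) - q.2 ^ 2) * h2 =
      b * ((h1 / a - q.1) * c1 - q.2 * c2 + q.1 * c4) ∧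
    q.1 * (h1 / a - q.1) - q.2 ^ 2 ≠ 0 with hS
  split_ifs with hδ
  · obtain ⟨rfl, rfl, rfl, rfl⟩ := hδ
    have hcompl : Sᶜ.card ≤ 2 * N := by
      refine le_trans (card_le_two_mul_of_quadratic_snd _ 1 (fun _ => 0) (fun x => x ^ 2)
        (fun _ => Or.inl one_ne_zero) ?_) hN2
      rintro ⟨x, y⟩ hq
      simp only [hS, Finset.mem_compl, Finset.mem_filter, Finset.mem_univ, true_and, not_and,
        not_not] at hq
      linear_combination -hq (by ring)
    have hadd : S.card + Sᶜ.card = N ^ 2 := by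
      rw [Finset.card_add_card_compl, Fintype.card_prod, ZMod.card, sq]
    have hcompl' : (Sᶜ.card : ℝ) ≤ 2 * N := by exact_mod_cast hcompl
    have hadd' : (S.card : ℝ) + Sᶜ.card = (N : ℝ) ^ 2 := by exact_mod_cast hadd
    rw [← hadd', sub_add_cancel_left, abs_neg, Nat.abs_cast]
    exact hcompl'
  · rw [sub_zero, Nat.abs_cast]
    suffices h : S.card ≤ 2 * N by exact_mod_cast h
    have hmem : ∀ q ∈ S, (q.1 * (h1 / a - q.1) - q.2 ^ 2) * h2 =
        b * ((h1 / a - q.1) * c1 - q.2 * c2 + q.1 * c4) := fun q hq =>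
      (Finset.mem_filter.mp hq).2.1
    by_cases hy : h2 ≠ 0 ∨ c2 ≠ 0
    · refine le_trans (card_le_two_mul_of_quadratic_snd S (-h2) (fun _ => b * c2)
        (fun x => x * (h1 / a - x) * h2 - b * ((h1 / a - x) * c1 + x * c4))
        (fun _ => hy.imp neg_ne_zero.mpr (mul_ne_zero hb)) fun q hq => ?_) hN2
      linear_combination hmem q hq
    push Not at hy
    obtain ⟨rfl, rfl⟩ := hy
    by_cases hx : c1 = c4
    · subst hx
      have hc1 : c1 ≠ 0 := by
        rintro rfl
        simp at hc
      have hh1 : h1 ≠ 0 := fun h => hδ ⟨h, rfl, rfl, rfl⟩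
      have hempty : S = ∅ := by
        refine Finset.eq_empty_of_forall_notMem fun q hq => ?_
        refine mul_ne_zero (mul_ne_zero hb (div_ne_zero hh1 ha)) hc1 ?_
        linear_combination -hmem q hq
      simp [hempty]
    · rw [← Finset.card_map (Equiv.prodComm (ZMod N) (ZMod N)).toEmbedding]
      refine le_trans (card_le_two_mul_of_quadratic_snd _ 0 (fun _ => b * (c4 - c1))
        (fun _ => b * (h1 / a * c1))
        (fun _ => Or.inr (mul_ne_zero hb (sub_ne_zero.mpr (Ne.symm hx)))) fun q hq => ?_) hN2
      obtain ⟨r, hr, rfl⟩ := Finset.mem_map.mp hq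
      simp only [Equiv.coe_toEmbedding, Equiv.prodComm_apply, Prod.snd_swap]
      linear_combination -hmem r hr
end

section
/- Let N be a prime with N ≡ 3 (mod 4), let a, b be integers coprime to N, and let c1, c2, c4, h1, h2 be integers with 4c1c4 − c2² ≢ 0 (mod N). If h1 ≢ 0 (mod N) or h2 ≢ 0 (mod N), then L(c1,c2,c4,h1,h2) ≤ N + 1. -/
/-- In a field where `-1` is not a square, a circle with a point `(x₀, y₀)` is covered by
the second intersections of the lines through that point. -/
theorem exists_cover_circle {F : Type*} [Field F] (hF : ¬ IsSquare (-1 : F)) (α β γ : F) :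
    ∃ g : Option F → F × F,
      ∀ x y : F, x ^ 2 + y ^ 2 + α * x + β * y + γ = 0 → ∃ t, g t = (x, y) := by
  by_cases h : ∃ x₀ y₀ : F, x₀ ^ 2 + y₀ ^ 2 + α * x₀ + β * y₀ + γ = 0
  swap
  · push Not at h
    exact ⟨fun _ ↦ 0, fun x y hxy ↦ (h x y hxy).elim⟩
  obtain ⟨x₀, y₀, h₀⟩ := h
  obtain ⟨p, hp⟩ : ∃ p, p = 2 * x₀ + α := ⟨_, rfl⟩
  obtain ⟨q, hq⟩ : ∃ q, q = 2 * y₀ + β := ⟨_, rfl⟩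
  refine ⟨fun o ↦ o.elim (x₀, y₀ - q)
    fun t ↦ (x₀ - (p + q * t) / (1 + t ^ 2), y₀ - (p + q * t) / (1 + t ^ 2) * t), ?_⟩
  intro x y hxy
  obtain ⟨u, rfl⟩ : ∃ u, x = x₀ + u := ⟨x - x₀, by ring⟩
  obtain ⟨v, rfl⟩ : ∃ v, y = y₀ + v := ⟨y - y₀, by ring⟩
  have huv : u ^ 2 + v ^ 2 + p * u + q * v = 0 := by
    rw [hp, hq]; linear_combination hxy - h₀
  by_cases hu : u = 0
  · subst hu
    have hv : v * (v + q) = 0 := by linear_combination huv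
    rcases mul_eq_zero.mp hv with rfl | hv
    · by_cases hq0 : q = 0
      · exact ⟨none, by simp [hq0]⟩
      · refine ⟨some (-p / q), ?_⟩
        have : p + q * (-p / q) = 0 := by field_simp; ring
        simp [this]
    · refine ⟨none, ?_⟩
      simp only [Option.elim, Prod.mk.injEq, add_zero, true_and]
      linear_combination -hv
  · have hs : u ^ 2 + v ^ 2 ≠ 0 := by
      intro hs
      refine hF ⟨v / u, ?_⟩
      field_simp
      linear_combination -hs
    have hl : (p + q * (v / u)) / (1 + (v / u) ^ 2) = -u := by
      have h1 : 1 + (v / u) ^ 2 = (u ^ 2 + v ^ 2) / u ^ 2 := by field_simp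
      rw [h1]
      field_simp
      linear_combination huv
    refine ⟨some (v / u), ?_⟩
    simp only [Option.elim, hl, Prod.mk.injEq]
    constructor
    · ring
    · field_simp
      ring

theorem exists_cover_line {F : Type*} [Field F] (A B C : F) (hAB : A ≠ 0 ∨ B ≠ 0) :
    ∃ g : Option F → F × F, ∀ x y : F, A * x + B * y + C = 0 → ∃ t, g t = (x, y) := by
  by_cases hB : B = 0
  · have hA : A ≠ 0 := hAB.resolve_right (not_not_intro hB)
    refine ⟨fun o ↦ (-C / A, o.getD 0), fun x y h ↦ ⟨some y, ?_⟩⟩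
    simp only [Option.getD_some, Prod.mk.injEq, and_true]
    field_simp
    linear_combination -h + y * hB
  · refine ⟨fun o ↦ (o.getD 0, (-C - A * o.getD 0) / B), fun x y h ↦ ⟨some x, ?_⟩⟩
    simp only [Option.getD_some, Prod.mk.injEq, true_and]
    field_simp
    linear_combination -h

/-- The points `(x, y)` for which `(x, y, s - x)` solves the second congruence lie on a
circle (`h ≠ 0`) or on a line (`h = 0`). -/
theorem exists_cover_conic {F : Type*} [Field F] (hF : ¬ IsSquare (-1 : F))
    (s h b c₁ c₂ c₄ : F) (hb : b ≠ 0) (hc : 4 * c₁ * c₄ - c₂ ^ 2 ≠ 0) (hsh : s ≠ 0 ∨ h ≠ 0) :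
    ∃ g : Option F → F × F, ∀ x y : F,
      (x * (s - x) - y ^ 2) * h = b * ((s - x) * c₁ - y * c₂ + x * c₄) → ∃ t, g t = (x, y) := by
  by_cases hh : h = 0
  · have hs : s ≠ 0 := hsh.resolve_right (not_not_intro hh)
    by_cases hAB : c₄ - c₁ ≠ 0 ∨ -c₂ ≠ 0
    · obtain ⟨g, hg⟩ := exists_cover_line (c₄ - c₁) (-c₂) (s * c₁) hAB
      refine ⟨g, fun x y hxy ↦ hg x y (mul_left_cancel₀ hb ?_)⟩
      linear_combination -hxy + (x * (s - x) - y ^ 2) * hh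
    · push Not at hAB
      obtain ⟨h₁, h₂⟩ := hAB
      have h₂ : c₂ = 0 := neg_eq_zero.mp h₂
      have h₁ : c₄ = c₁ := sub_eq_zero.mp h₁
      subst h₁ h₂ hh
      refine ⟨fun _ ↦ 0, fun x y hxy ↦ (hc ?_).elim⟩
      have : b * s * c₄ = 0 := by linear_combination -hxy
      have : c₄ = 0 := (mul_eq_zero.mp this).resolve_left (mul_ne_zero hb hs)
      simp [this]
  · obtain ⟨g, hg⟩ := exists_cover_circle hF (-s + b * (c₄ - c₁) / h) (-b * c₂ / h)
      (b * s * c₁ / h)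
    refine ⟨g, fun x y hxy ↦ hg x y ?_⟩
    field_simp
    linear_combination -hxy

theorem stmt1 (N : ℕ) (hN : N.Prime) (h4 : N % 4 = 3)
    (a b c1 c2 c4 h1 h2 : ℤ) (ha : Int.gcd a N = 1) (hb : Int.gcd b N = 1)
    (hc : ((4 * c1 * c4 - c2 ^ 2 : ℤ) : ZMod N) ≠ 0)
    (hh : (h1 : ZMod N) ≠ 0 ∨ (h2 : ZMod N) ≠ 0) :
    Lcount N a b c1 c2 c4 h1 h2 ≤ N + 1 := by
  have : Fact N.Prime := ⟨hN⟩
  have unit_of_gcd : ∀ z : ℤ, Int.gcd z N = 1 → (z : ZMod N) ≠ 0 := fun z hz h0 ↦ by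
    have hdvd : (N : ℤ) ∣ Int.gcd z N :=
      Int.dvd_coe_gcd ((ZMod.intCast_zmod_eq_zero_iff_dvd z N).mp h0) dvd_rfl
    rw [hz] at hdvd
    exact hN.one_lt.ne' (Nat.dvd_one.mp (by exact_mod_cast hdvd))
  have ha' := unit_of_gcd a ha
  have hF : ¬ IsSquare (-1 : ZMod N) := fun h ↦ ZMod.exists_sq_eq_neg_one_iff.mp h h4
  push_cast at hc
  obtain ⟨g, hg⟩ := exists_cover_conic hF ((h1 : ZMod N) / a) h2 b c1 c2 c4
    (unit_of_gcd b hb) hc (hh.imp_left fun h ↦ div_ne_zero h ha')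
  have key : ∀ d : ZMod N × ZMod N × ZMod N, (h1 : ZMod N) = a * (d.1 + d.2.2) →
      d.2.2 = (h1 : ZMod N) / a - d.1 := fun d hd ↦ by
    rw [hd]; field_simp; ring
  unfold Lcount
  calc _ ≤ Nat.card (Option (ZMod N)) := by
        choose! f hf using hg
        refine Nat.card_le_card_of_injective (fun d ↦ f d.1.1 d.1.2.1) ?_
        rintro ⟨d, hd, hd', _⟩ ⟨e, he, he', _⟩ hde
        rw [key d hd] at hd'
        rw [key e he] at he'
        have h := (hf _ _ hd').symm.trans ((congrArg g hde).trans (hf _ _ he'))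
        obtain ⟨hx, hy⟩ := Prod.mk.inj h
        refine Subtype.ext (Prod.ext hx (Prod.ext hy ?_))
        change d.2.2 = e.2.2
        rw [key d hd, key e he, hx]
    _ = N + 1 := by simp
end

section
/- Let N be a prime with N ≡ 3 (mod 4), let a, b be integers coprime to N, and let c1, c2, c4, h1, h2 be integers with 4c1c4 − c2² ≢ 0 (mod N). If h1 ≡ h2 ≡ 0 (mod N) but it is not the case that both c1 ≡ c4 (mod N) and c2 ≡ 0 (mod N), then L(c1,c2,c4,h1,h2) ≤ N. -/
theorem ZMod.intCast_ne_zero_of_gcd_eq_one_s2 {p : ℕ} (hp : p.Prime) {a : ℤ}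
    (ha : Int.gcd a p = 1) : (a : ZMod p) ≠ 0 := by
  intro h
  have hdvd : (p : ℤ) ∣ a := (ZMod.intCast_zmod_eq_zero_iff_dvd a p).mp h
  have hone : p ∣ Int.gcd a p := Int.dvd_gcd hdvd dvd_rfl
  exact hp.one_lt.ne' (Nat.dvd_one.mp (ha ▸ hone))

theorem stmt2 (N : ℕ) (hN : N.Prime) (h4 : N % 4 = 3)
    (a b c1 c2 c4 h1 h2 : ℤ) (ha : Int.gcd a N = 1) (hb : Int.gcd b N = 1)
    (hc : ((4 * c1 * c4 - c2 ^ 2 : ℤ) : ZMod N) ≠ 0)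
    (hh1 : (h1 : ZMod N) = 0) (hh2 : (h2 : ZMod N) = 0)
    (hcc : ¬ ((c1 : ZMod N) = (c4 : ZMod N) ∧ (c2 : ZMod N) = 0)) :
    Lcount N a b c1 c2 c4 h1 h2 ≤ N := by
  have : Fact N.Prime := ⟨hN⟩
  have ha0 := ZMod.intCast_ne_zero_of_gcd_eq_one_s2 hN ha
  have hb0 := ZMod.intCast_ne_zero_of_gcd_eq_one_s2 hN hb
  unfold Lcount
  rw [hh1, hh2]
  conv_rhs => rw [← Nat.card_zmod N]
  have trace_eq {x z : ZMod N} (h : 0 = (a : ZMod N) * (x + z)) : z = -x :=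
    eq_neg_of_add_eq_zero_right ((mul_eq_zero.mp h.symm).resolve_left ha0)
  have line_eq {x y z : ZMod N} (h : 0 = (a : ZMod N) * (x + z))
      (h' : (x * z - y ^ 2) * 0 = (b : ZMod N) * (z * c1 - y * c2 + x * c4)) :
      (c2 : ZMod N) * y = (c4 - c1) * x := by
    rw [mul_zero] at h'
    have hz := (mul_eq_zero.mp h'.symm).resolve_left hb0
    rw [trace_eq h] at hz
    linear_combination -hz
  by_cases h2 : (c2 : ZMod N) = 0
  · have hne : (c4 : ZMod N) - c1 ≠ 0 := fun h => hcc ⟨(sub_eq_zero.mp h).symm, h2⟩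
    have fst_eq {x y : ZMod N} (h : (c2 : ZMod N) * y = (c4 - c1) * x) : x = 0 := by
      rw [h2, zero_mul] at h
      exact (mul_eq_zero.mp h.symm).resolve_left hne
    refine Nat.card_le_card_of_injective (fun d => d.1.2.1) ?_
    rintro ⟨⟨x, y, z⟩, hx, hy, _⟩ ⟨⟨x', y', z'⟩, hx', hy', _⟩ h
    dsimp only at hx hy hx' hy' h
    have e := fst_eq (line_eq hx hy)
    have e' := fst_eq (line_eq hx' hy')
    simp [trace_eq hx, trace_eq hx', e, e', h]
  · refine Nat.card_le_card_of_injective (fun d => d.1.1) ?_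
    rintro ⟨⟨x, y, z⟩, hx, hy, _⟩ ⟨⟨x', y', z'⟩, hx', hy', _⟩ h
    dsimp only at hx hy hx' hy' h
    have e : y = y' := mul_left_cancel₀ h2 (by rw [line_eq hx hy, line_eq hx' hy', h])
    simp [trace_eq hx, trace_eq hx', e, h]
end
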